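/- Closedness of the constraint-cost image set: for ε > 0 and M > 0, the set D := {(𝒜(γ,ξ), ∫(k+2ε) dγ + Mε·ξ(Y×U)) : (γ,ξ) ∈ ℳ₊(Y×U)²} is closed in the weak* topology of ℝ × (C¹)* × (C¹)* × ℝ, where 𝒜(γ,ξ) := (γ(Y×U), a_{(γ,ξ)}, b_γ) with a_{(γ,ξ)}(φ) := −[∫(φ(y₀)−φ(y)) dγ + ∫∇φ·f dξ] and b_γ(φ) := −∫∇φ·f dγ. -/

import Mathlib

open MeasureTheory Filter Topology Set

/-- Along an ultrafilter, finite measures of bounded mass carried by a common compact set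
converge weakly to a finite measure carried by the same set. -/
theorem exists_tendsto_integral_of_isCompact_support
    {X : Type*} [TopologicalSpace X] [T2Space X] [MeasurableSpace X] [BorelSpace X]
    {K : Set X} (hK : IsCompact K) {ι : Type*} (G : Ultrafilter ι) (μ : ι → Measure X)
    (hfin : ∀ l, IsFiniteMeasure (μ l)) (hsupp : ∀ l, μ l Kᶜ = 0) (C : ℝ)
    (hC : ∀ᶠ l in G, (μ l univ).toReal ≤ C) :
    ∃ ν : Measure X, IsFiniteMeasure ν ∧ ν Kᶜ = 0 ∧
      ∀ g : X → ℝ, Continuous g →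
        Tendsto (fun l => ∫ x, g x ∂(μ l)) G (𝓝 (∫ x, g x ∂ν)) := by
  have : CompactSpace K := isCompact_iff_compactSpace.mp hK
  have hKm : MeasurableSet K := hK.measurableSet
  have hemb : MeasurableEmbedding (Subtype.val : K → X) := MeasurableEmbedding.subtype_coe hKm
  have hmass (l : ι) : (μ l).comap (Subtype.val : K → X) univ = μ l univ := by
    rw [hemb.comap_apply, image_univ, Subtype.range_coe,
      measure_of_measure_compl_eq_zero (hsupp l)]
  have hfin' (l : ι) : IsFiniteMeasure ((μ l).comap (Subtype.val : K → X)) :=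
    ⟨by rw [hmass]; exact measure_lt_top _ _⟩
  let P (l : ι) : FiniteMeasure K := ⟨(μ l).comap Subtype.val, hfin' l⟩
  have hP : ∀ᶠ l in G, P l ∈ {ρ : FiniteMeasure K | ρ.mass ≤ C.toNNReal} := by
    filter_upwards [hC] with l hl
    have : ((P l).mass : ℝ) = (μ l univ).toReal := by
      rw [← hmass l]; rfl
    exact NNReal.le_toNNReal_of_coe_le (this.trans_le hl)
  obtain ⟨ρ, -, hρ⟩ := (isCompact_setOfPred_finiteMeasure_le_of_compactSpace K
    C.toNNReal).ultrafilter_le_nhds' (G.map P) hP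
  have hlim : Tendsto P G (𝓝 ρ) := hρ
  refine ⟨(ρ : Measure K).map Subtype.val, inferInstance, ?_, fun g hg => ?_⟩
  · rw [hemb.map_apply]
    simp
  · have h := FiniteMeasure.tendsto_iff_forall_integral_tendsto.mp hlim
      (BoundedContinuousFunction.mkOfCompact ⟨fun x : K => g x, hg.comp continuous_subtype_val⟩)
    rw [hemb.integral_map]
    refine h.congr fun l => ?_
    change ∫ x : K, g x ∂((μ l).comap Subtype.val) = _
    rw [integral_subtype_comap hKm, Measure.restrict_eq_self_of_ae_mem]
    exact mem_ae_iff.mpr (hsupp l)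

/-- Closedness of the constraint-cost image set D in the weak* topology: any weak* convergent
net of points 𝒜(γ_l,ξ_l) together with costs, with (γ_l,ξ_l) ∈ ℳ₊(Y×U)², has its limit of the
form (𝒜(γ,ξ), cost(γ,ξ)) for some (γ,ξ) ∈ ℳ₊(Y×U)². -/
theorem constraint_cost_image_closed
    {m : ℕ} {U : Type} [MetricSpace U] [CompactSpace U] [MeasurableSpace U] [BorelSpace U]
    (Y : Set (EuclideanSpace ℝ (Fin m))) (hY : IsCompact Y)
    (f : EuclideanSpace ℝ (Fin m) → U → EuclideanSpace ℝ (Fin m))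
    (hf : Continuous (fun p : EuclideanSpace ℝ (Fin m) × U => f p.1 p.2))
    (k : EuclideanSpace ℝ (Fin m) → U → ℝ)
    (hk : Continuous (fun p : EuclideanSpace ℝ (Fin m) × U => k p.1 p.2))
    (y0 : EuclideanSpace ℝ (Fin m)) (hy0 : y0 ∈ Y)
    (ε M : ℝ) (hε : 0 < ε) (hM : 0 < M)
    {ι : Type} (F : Filter ι) (hFne : F.NeBot)
    (γl ξl : ι → Measure (EuclideanSpace ℝ (Fin m) × U))
    (hfin : ∀ l, IsFiniteMeasure (γl l) ∧ IsFiniteMeasure (ξl l))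
    (hsupp : ∀ l, (γl l) ((Y ×ˢ (univ : Set U))ᶜ) = 0 ∧ (ξl l) ((Y ×ˢ (univ : Set U))ᶜ) = 0)
    (z1 : ℝ) (A B : (EuclideanSpace ℝ (Fin m) → ℝ) → ℝ) (β : ℝ)
    -- convergence of the mass component
    (h1 : Tendsto (fun l => ((γl l) Set.univ).toReal) F (𝓝 z1))
    -- weak* convergence of the functional components a_{(γ_l,ξ_l)} and b_{γ_l}
    (hA : ∀ φ : EuclideanSpace ℝ (Fin m) → ℝ, ContDiff ℝ 1 φ →
      Tendsto (fun l => -((∫ p, (φ y0 - φ p.1) ∂(γl l)) +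
        ∫ p, fderiv ℝ φ p.1 (f p.1 p.2) ∂(ξl l))) F (𝓝 (A φ)))
    (hB : ∀ φ : EuclideanSpace ℝ (Fin m) → ℝ, ContDiff ℝ 1 φ →
      Tendsto (fun l => -(∫ p, fderiv ℝ φ p.1 (f p.1 p.2) ∂(γl l))) F (𝓝 (B φ)))
    -- convergence of the cost component
    (hc : Tendsto (fun l => (∫ p, (k p.1 p.2 + 2 * ε) ∂(γl l)) +
      M * ε * ((ξl l) Set.univ).toReal) F (𝓝 β)) :
    ∃ γ ξ : Measure (EuclideanSpace ℝ (Fin m) × U),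
      IsFiniteMeasure γ ∧ IsFiniteMeasure ξ ∧
      γ ((Y ×ˢ (univ : Set U))ᶜ) = 0 ∧ ξ ((Y ×ˢ (univ : Set U))ᶜ) = 0 ∧
      (γ Set.univ).toReal = z1 ∧
      (∀ φ : EuclideanSpace ℝ (Fin m) → ℝ, ContDiff ℝ 1 φ →
        -((∫ p, (φ y0 - φ p.1) ∂γ) + ∫ p, fderiv ℝ φ p.1 (f p.1 p.2) ∂ξ) = A φ ∧
        -(∫ p, fderiv ℝ φ p.1 (f p.1 p.2) ∂γ) = B φ) ∧
      (∫ p, (k p.1 p.2 + 2 * ε) ∂γ) + M * ε * (ξ Set.univ).toReal = β := by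
  have hK : IsCompact (Y ×ˢ (univ : Set U)) := hY.prod isCompact_univ
  let G : Ultrafilter ι := Ultrafilter.of F
  have hG : (G : Filter ι) ≤ F := Ultrafilter.of_le F
  have hk' : Continuous fun p : EuclideanSpace ℝ (Fin m) × U => k p.1 p.2 + 2 * ε :=
    hk.add continuous_const
  obtain ⟨Ck, hCk⟩ := hK.exists_bound_of_continuousOn hk'.continuousOn
  have hCk0 : 0 ≤ max Ck 0 := le_max_right _ _
  have hγC : ∀ᶠ l in G, ((γl l) univ).toReal ≤ z1 + 1 :=
    (h1.mono_left hG).eventually_le_const (lt_add_one z1)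
  have hξC : ∀ᶠ l in G, ((ξl l) univ).toReal ≤ (β + 1 + max Ck 0 * (z1 + 1)) / (M * ε) := by
    filter_upwards [hγC, (hc.mono_left hG).eventually_le_const (lt_add_one β)] with l hl hcl
    have := (hfin l).1
    have hbound : ‖∫ p, (k p.1 p.2 + 2 * ε) ∂(γl l)‖ ≤ max Ck 0 * (γl l).real univ := by
      refine norm_integral_le_of_norm_le_const ?_
      have hae : ∀ᵐ p ∂(γl l), p ∈ Y ×ˢ (univ : Set U) := mem_ae_iff.mpr (hsupp l).1
      filter_upwards [hae] with p hp
      exact (hCk p hp).trans (le_max_left _ _)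
    have hmul : max Ck 0 * (γl l).real univ ≤ max Ck 0 * (z1 + 1) :=
      mul_le_mul_of_nonneg_left hl hCk0
    have hneg := neg_le_of_abs_le hbound
    rw [le_div_iff₀ (mul_pos hM hε)]
    linarith
  obtain ⟨γ, hγfin, hγsupp, hγ⟩ := exists_tendsto_integral_of_isCompact_support hK G γl
    (fun l => (hfin l).1) (fun l => (hsupp l).1) _ hγC
  obtain ⟨ξ, hξfin, hξsupp, hξ⟩ := exists_tendsto_integral_of_isCompact_support hK G ξl
    (fun l => (hfin l).2) (fun l => (hsupp l).2) _ hξC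
  have hγ1 : Tendsto (fun l => ((γl l) univ).toReal) G (𝓝 (γ univ).toReal) := by
    simpa [Measure.real] using hγ (fun _ => 1) continuous_const
  have hξ1 : Tendsto (fun l => ((ξl l) univ).toReal) G (𝓝 (ξ univ).toReal) := by
    simpa [Measure.real] using hξ (fun _ => 1) continuous_const
  refine ⟨γ, ξ, hγfin, hξfin, hγsupp, hξsupp, tendsto_nhds_unique hγ1 (h1.mono_left hG),
    fun φ hφ => ?_, tendsto_nhds_unique ((hγ _ hk').add (hξ1.const_mul _)) (hc.mono_left hG)⟩
  have hd : Continuous fun p : EuclideanSpace ℝ (Fin m) × U => fderiv ℝ φ p.1 (f p.1 p.2) :=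
    ((hφ.continuous_fderiv one_ne_zero).comp continuous_fst).clm_apply hf
  have hs : Continuous fun p : EuclideanSpace ℝ (Fin m) × U => φ y0 - φ p.1 :=
    continuous_const.sub (hφ.continuous.comp continuous_fst)
  exact ⟨tendsto_nhds_unique ((hγ _ hs).add (hξ _ hd)).neg ((hA φ hφ).mono_left hG),
    tendsto_nhds_unique (hγ _ hd).neg ((hB φ hφ).mono_left hG)⟩
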